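/- arXiv:2402.06024 — 3 statements merged into one kernel-verified Lean document; each statement's English description precedes it below -/
import Mathlib

section
/- Let X be a finite set with |X| ≥ 3 and n ≥ 2 voters. Every social welfare function F : W(X)^n → W(X) defined on the unrestricted domain W(X)^n that satisfies unanimity and IIA is dictatorial. -/
open Set
namespace ArrowSC

/-- A profile assigns to each voter a binary relation (their preference) on alternatives. -/
abbrev Profile (n : ℕ) (X : Type*) := Fin n → X → X → Prop

/-- `r` is a strict total order. -/
def IsSTO {X : Type*} (r : X → X → Prop) : Prop :=
  (∀ x, ¬ r x x) ∧ (∀ x y z, r x y → r y z → r x z) ∧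
  (∀ x y, x ≠ y → r x y ∨ r y x)

/-- A genuine profile: every voter's relation is a strict total order, i.e. a member of W(X)^n. -/
def IsProfile {n : ℕ} {X : Type*} (P : Profile n X) : Prop := ∀ i, IsSTO (P i)

/-- A domain: a nonempty set of profiles, each a member of W(X)^n. -/
def IsDomain {n : ℕ} {X : Type*} (D : Set (Profile n X)) : Prop :=
  D.Nonempty ∧ ∀ P ∈ D, IsProfile P

/-- `F` is a social welfare function on `D`: it sends each profile in `D` to a strict total order. -/
def IsSWF {n : ℕ} {X : Type*} (D : Set (Profile n X))
    (F : Profile n X → X → X → Prop) : Prop :=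
  ∀ P ∈ D, IsSTO (F P)

def Unanimity {n : ℕ} {X : Type*} (D : Set (Profile n X))
    (F : Profile n X → X → X → Prop) : Prop :=
  ∀ P ∈ D, ∀ a b : X, (∀ i, P i a b) → F P a b

def IIA {n : ℕ} {X : Type*} (D : Set (Profile n X))
    (F : Profile n X → X → X → Prop) : Prop :=
  ∀ P ∈ D, ∀ P' ∈ D, ∀ a b : X, (∀ i, P i a b ↔ P' i a b) → (F P a b ↔ F P' a b)

def IsDictator {n : ℕ} {X : Type*} (D : Set (Profile n X))
    (F : Profile n X → X → X → Prop) (d : Fin n) : Prop :=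
  ∀ P ∈ D, ∀ a b : X, P d a b → F P a b

def Dictatorial {n : ℕ} {X : Type*} (D : Set (Profile n X))
    (F : Profile n X → X → X → Prop) : Prop :=
  ∃ d, IsDictator D F d

/-- Coalition `G` is almost-decisive over the ordered pair `(a, b)` w.r.t. `F`. -/
def AlmostDecisivePair {n : ℕ} {X : Type*} (D : Set (Profile n X))
    (F : Profile n X → X → X → Prop) (G : Set (Fin n)) (a b : X) : Prop :=
  ∀ P ∈ D, (∀ i, P i a b ↔ i ∈ G) → F P a b

/-- Coalition `G` is almost-decisive over `Y` w.r.t. `F`. -/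
def AlmostDecisiveOn {n : ℕ} {X : Type*} (D : Set (Profile n X))
    (F : Profile n X → X → X → Prop) (G : Set (Fin n)) (Y : Set X) : Prop :=
  ∀ a ∈ Y, ∀ b ∈ Y, a ≠ b → AlmostDecisivePair D F G a b

/-- Coalition `G` is almost-decisive (over all of X) w.r.t. `F`. -/
def AlmostDecisive {n : ℕ} {X : Type*} (D : Set (Profile n X))
    (F : Profile n X → X → X → Prop) (G : Set (Fin n)) : Prop :=
  ∀ a b : X, a ≠ b → AlmostDecisivePair D F G a b

/-- The restriction of `r` to the triple `{a,b,c}` is the order `a` above `b` above `c`. -/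
def RanksTriple {X : Type*} (r : X → X → Prop) (a b c : X) : Prop :=
  r a b ∧ r b c ∧ r a c

/-- The polarized profile `(G : abc, Gᶜ : a'b'c')` on a triple is a subprofile of `D`,
i.e. it belongs to the restriction `D|_{triple}`. -/
def HasPolarizedSubprofile {n : ℕ} {X : Type*} (D : Set (Profile n X)) (G : Set (Fin n))
    (a b c a' b' c' : X) : Prop :=
  ∃ P ∈ D, ∀ i, (i ∈ G → RanksTriple (P i) a b c) ∧ (i ∉ G → RanksTriple (P i) a' b' c')

/-- `D_1(G, {a,b,c}) ⊆ D|_{{a,b,c}}`. -/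
def D1sub {n : ℕ} {X : Type*} (D : Set (Profile n X)) (G : Set (Fin n)) (a b c : X) : Prop :=
  HasPolarizedSubprofile D G b c a a b c ∧
  HasPolarizedSubprofile D G b a c a c b ∧
  HasPolarizedSubprofile D G a b c c a b ∧
  HasPolarizedSubprofile D G a c b c b a ∧
  HasPolarizedSubprofile D G c a b b c a ∧
  HasPolarizedSubprofile D G c b a b a c

/-- `D_2(G, {a,b,c}) ⊆ D|_{{a,b,c}}`. -/
def D2sub {n : ℕ} {X : Type*} (D : Set (Profile n X)) (G : Set (Fin n)) (a b c : X) : Prop :=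
  HasPolarizedSubprofile D G a b c b c a ∧
  HasPolarizedSubprofile D G a c b b a c ∧
  HasPolarizedSubprofile D G c a b a b c ∧
  HasPolarizedSubprofile D G c b a a c b ∧
  HasPolarizedSubprofile D G b c a c a b ∧
  HasPolarizedSubprofile D G b a c c b a

/-- The class 𝒟^PT of polarization over triples. -/
def ClassPT {n : ℕ} {X : Type*} (D : Set (Profile n X)) : Prop :=
  ∀ G : Set (Fin n), G ≠ ∅ → G ≠ univ →
    ∀ a b c : X, a ≠ b → b ≠ c → a ≠ c →
      D1sub D G a b c ∨ D2sub D G a b c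

/-- The class 𝒟^DT of diversity over triples. -/
def ClassDT {n : ℕ} {X : Type*} (D : Set (Profile n X)) : Prop :=
  ∀ G G' : Set (Fin n), ¬ G ⊆ G' → ¬ G' ⊆ G →
    ∃ a b c : X, a ≠ b ∧ b ≠ c ∧ a ≠ c ∧ ∃ P ∈ D, ∀ i,
      (P i a b ↔ i ∈ G) ∧ (P i b c ↔ i ∈ G') ∧ (P i c a ↔ i ∉ G ∩ G')

/-- `D` is Arrow-inconsistent. -/
def ArrowInconsistent {n : ℕ} {X : Type*} (D : Set (Profile n X)) : Prop :=
  ∀ F : Profile n X → X → X → Prop,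
    IsSWF D F → Unanimity D F → IIA D F → Dictatorial D F

/-- `a` is the most-preferred among `{a,b,c}` according to `r`. -/
def TripleBest {X : Type*} (r : X → X → Prop) (a b c : X) : Prop := r a b ∧ r a c

/-- `a` is the least-preferred among `{a,b,c}` according to `r`. -/
def TripleWorst {X : Type*} (r : X → X → Prop) (a b c : X) : Prop := r b a ∧ r c a

/-- `a` is the middle-preferred among `{a,b,c}` according to `r`. -/
def TripleMiddle {X : Type*} (r : X → X → Prop) (a b c : X) : Prop :=
  (r b a ∧ r a c) ∨ (r c a ∧ r a b)

/-- In profile `P`, alternative `a` is never placed as the most-preferred, or never as the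
middle-preferred, or never as the least-preferred alternative among `{a,b,c}`. -/
def NeverBMW {n : ℕ} {X : Type*} (P : Profile n X) (a b c : X) : Prop :=
  (∀ i, ¬ TripleBest (P i) a b c) ∨ (∀ i, ¬ TripleMiddle (P i) a b c) ∨
  (∀ i, ¬ TripleWorst (P i) a b c)

/-- Sen's value-restriction of a profile over `Y`. -/
def ValueRestricted {n : ℕ} {X : Type*} (P : Profile n X) (Y : Set X) : Prop :=
  ∀ a ∈ Y, ∀ b ∈ Y, ∀ c ∈ Y, a ≠ b → b ≠ c → a ≠ c →
    NeverBMW P a b c ∨ NeverBMW P b a c ∨ NeverBMW P c a b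

/-- The strict total order on the triple `{a,b,c}` ranking `a` above `b` above `c`,
viewed as a relation with support in `{a,b,c}`. -/
def seqOrder {X : Type*} (a b c : X) : X → X → Prop :=
  fun x y => (x = a ∧ y = b) ∨ (x = b ∧ y = c) ∨ (x = a ∧ y = c)

/-- `r` is a strict total order on the triple `{a,b,c}` (with support in the triple). -/
def IsTripleOrder {X : Type*} (a b c : X) (r : X → X → Prop) : Prop :=
  (∀ x y, r x y → x ∈ ({a, b, c} : Set X) ∧ y ∈ ({a, b, c} : Set X)) ∧
  (∀ x, ¬ r x x) ∧ (∀ x y z, r x y → r y z → r x z) ∧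
  (∀ x ∈ ({a, b, c} : Set X), ∀ y ∈ ({a, b, c} : Set X), x ≠ y → r x y ∨ r y x)

/-- The polarized profile `(G : Q, Gᶜ : Q')`. -/
def polarizedProfile {n : ℕ} {X : Type*} (G : Set (Fin n)) (Q Q' : X → X → Prop) :
    Profile n X :=
  fun i x y => (i ∈ G ∧ Q x y) ∨ (i ∉ G ∧ Q' x y)

/-- `Q` and `Q'` differ on how they rank the pair `{x, y}`. -/
def DifferOn {X : Type*} (Q Q' : X → X → Prop) (x y : X) : Prop := ¬ (Q x y ↔ Q' x y)

/-- `Q` and `Q'` differ on exactly two of the three unordered pairs of the triple `{a,b,c}`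
and coincide on the remaining pair. -/
def StronglyPolarizedPair {X : Type*} (a b c : X) (Q Q' : X → X → Prop) : Prop :=
  (DifferOn Q Q' a b ∧ DifferOn Q Q' b c ∧ ¬ DifferOn Q Q' a c) ∨
  (DifferOn Q Q' a b ∧ ¬ DifferOn Q Q' b c ∧ DifferOn Q Q' a c) ∨
  (¬ DifferOn Q Q' a b ∧ DifferOn Q Q' b c ∧ DifferOn Q Q' a c)

/-- The set `D_1(G, {a,b,c})` of polarized profiles on the triple `{a,b,c}`. -/
def D1set {n : ℕ} {X : Type*} (G : Set (Fin n)) (a b c : X) : Set (Profile n X) :=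
  { polarizedProfile G (seqOrder b c a) (seqOrder a b c),
    polarizedProfile G (seqOrder b a c) (seqOrder a c b),
    polarizedProfile G (seqOrder a b c) (seqOrder c a b),
    polarizedProfile G (seqOrder a c b) (seqOrder c b a),
    polarizedProfile G (seqOrder c a b) (seqOrder b c a),
    polarizedProfile G (seqOrder c b a) (seqOrder b a c) }

/-- The set `D_2(G, {a,b,c})` of polarized profiles on the triple `{a,b,c}`. -/
def D2set {n : ℕ} {X : Type*} (G : Set (Fin n)) (a b c : X) : Set (Profile n X) :=
  { polarizedProfile G (seqOrder a b c) (seqOrder b c a),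
    polarizedProfile G (seqOrder a c b) (seqOrder b a c),
    polarizedProfile G (seqOrder c a b) (seqOrder a b c),
    polarizedProfile G (seqOrder c b a) (seqOrder a c b),
    polarizedProfile G (seqOrder b c a) (seqOrder c a b),
    polarizedProfile G (seqOrder b a c) (seqOrder c b a) }

/-- The set of all strongly polarized profiles on the triple `{a,b,c}`
of the form `(G : Q, Gᶜ : Q')`. -/
def SPset {n : ℕ} {X : Type*} (G : Set (Fin n)) (a b c : X) : Set (Profile n X) :=
  { p | ∃ Q Q', IsTripleOrder a b c Q ∧ IsTripleOrder a b c Q' ∧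
      StronglyPolarizedPair a b c Q Q' ∧ p = polarizedProfile G Q Q' }

section

variable {X : Type*} {n : ℕ} {F : Profile n X → X → X → Prop} {G H : Set (Fin n)} {a b c : X}

/-- Break ties of a family of rankings by a fixed well-order to obtain a profile. -/
theorem exists_isProfile_of_rank (u : Fin n → X → ℕ) :
    ∃ P : Profile n X, IsProfile P ∧ ∀ i x y, u i x ≠ u i y → (P i x y ↔ u i x < u i y) := by
  refine ⟨fun i x y => u i x < u i y ∨ (u i x = u i y ∧ WellOrderingRel x y),
    fun i => ⟨?_, ?_, ?_⟩, ?_⟩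
  · rintro x (h | ⟨-, h⟩)
    · exact lt_irrefl _ h
    · exact irrefl_of WellOrderingRel x h
  · rintro x y z (h | ⟨h, h'⟩) (k | ⟨k, k'⟩)
    · exact Or.inl (h.trans k)
    · exact Or.inl (k ▸ h)
    · exact Or.inl (h ▸ k)
    · exact Or.inr ⟨h.trans k, trans_of WellOrderingRel h' k'⟩
  · intro x y hxy
    rcases lt_trichotomy (u i x) (u i y) with h | h | h
    · exact Or.inl (Or.inl h)
    · rcases trichotomous_of WellOrderingRel x y with k | k | k
      · exact Or.inl (Or.inr ⟨h, k⟩)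
      · exact absurd k hxy
      · exact Or.inr (Or.inr ⟨h.symm, k⟩)
    · exact Or.inr (Or.inl h)
  · intro i x y h
    simp [h]

theorem exists_isProfile_inter (hab : a ≠ b) (hbc : b ≠ c) (hac : a ≠ c) (G H : Set (Fin n)) :
    ∃ P : Profile n X, IsProfile P ∧ ∀ i, (P i a b ↔ i ∈ G) ∧ (P i b c ↔ i ∈ H) ∧
      (P i a c ↔ i ∈ G ∩ H) := by
  classical
  obtain ⟨P, hP, hPu⟩ := exists_isProfile_of_rank (n := n) (X := X) fun i x =>
    if x = a then (if i ∈ G then (if i ∈ H then 0 else 1) else 2)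
    else if x = b then (if i ∈ H then (if i ∈ G then 1 else 0) else (if i ∈ G then 2 else 1))
    else if i ∈ H then (if i ∈ G then 2 else 1) else 0
  refine ⟨P, hP, fun i => ?_⟩
  have h₁ := hPu i a b
  have h₂ := hPu i b c
  have h₃ := hPu i a c
  by_cases hG : i ∈ G <;> by_cases hH : i ∈ H <;>
    simp_all [hab.symm, hbc.symm, hac.symm]

theorem IsSTO.asymm {r : X → X → Prop} (hr : IsSTO r) (h : r a b) : ¬ r b a :=
  fun h' => hr.1 a (hr.2.1 _ _ _ h h')

theorem IsSTO.not_iff {r : X → X → Prop} (hr : IsSTO r) (hab : a ≠ b) : ¬ r a b ↔ r b a :=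
  ⟨(hr.2.2 a b hab).resolve_left, hr.asymm⟩

theorem almostDecisive_univ (hU : Unanimity {P : Profile n X | IsProfile P} F) :
    AlmostDecisive {P : Profile n X | IsProfile P} F univ :=
  fun a b _ P hP h => hU P hP a b fun i => (h i).2 (mem_univ i)

theorem AlmostDecisivePair.inter (hF : IsSWF {P : Profile n X | IsProfile P} F)
    (hIIA : IIA {P : Profile n X | IsProfile P} F) (hab : a ≠ b) (hbc : b ≠ c) (hac : a ≠ c)
    (hG : AlmostDecisivePair {P : Profile n X | IsProfile P} F G a b)
    (hH : AlmostDecisivePair {P : Profile n X | IsProfile P} F H b c) :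
    AlmostDecisivePair {P : Profile n X | IsProfile P} F (G ∩ H) a c := by
  intro P hP h
  obtain ⟨Q, hQ, hQi⟩ := exists_isProfile_inter hab hbc hac G H
  rw [hIIA P hP Q hQ a c fun i => (h i).trans (hQi i).2.2.symm]
  exact (hF Q hQ).2.1 a b c (hG Q hQ fun i => (hQi i).1) (hH Q hQ fun i => (hQi i).2.1)

theorem exists_ne_ne [Fintype X] (hX : 3 ≤ Fintype.card X) (a b : X) : ∃ c, c ≠ a ∧ c ≠ b := by
  classical
  have h : ({a, b} : Finset X).card < (Finset.univ : Finset X).card :=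
    Finset.card_le_two.trans_lt hX
  obtain ⟨c, -, hc⟩ := Finset.exists_mem_notMem_of_card_lt_card h
  exact ⟨c, by simpa using hc⟩

/-- The field expansion lemma: almost-decisiveness spreads from one pair to all pairs. -/
theorem AlmostDecisivePair.almostDecisive [Fintype X] (hX : 3 ≤ Fintype.card X)
    (hF : IsSWF {P : Profile n X | IsProfile P} F)
    (hU : Unanimity {P : Profile n X | IsProfile P} F)
    (hIIA : IIA {P : Profile n X | IsProfile P} F) (hab : a ≠ b)
    (hG : AlmostDecisivePair {P : Profile n X | IsProfile P} F G a b) :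
    AlmostDecisive {P : Profile n X | IsProfile P} F G := by
  have right {x y z : X} (hxy : x ≠ y) (hxz : x ≠ z)
      (h : AlmostDecisivePair {P : Profile n X | IsProfile P} F G x y) :
      AlmostDecisivePair {P : Profile n X | IsProfile P} F G x z := by
    obtain rfl | hyz := eq_or_ne y z
    · exact h
    · simpa using h.inter hF hIIA hxy hyz hxz (almostDecisive_univ hU y z hyz)
  have left {x y z : X} (hxy : x ≠ y) (hzy : z ≠ y)
      (h : AlmostDecisivePair {P : Profile n X | IsProfile P} F G x y) :
      AlmostDecisivePair {P : Profile n X | IsProfile P} F G z y := by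
    obtain rfl | hzx := eq_or_ne z x
    · exact h
    · simpa using (almostDecisive_univ hU z x hzx).inter hF hIIA hzx hxy hzy h
  intro x y hxy
  obtain ⟨c, hca, hcx⟩ := exists_ne_ne hX a x
  exact right hcx.symm hxy (left hca.symm hcx.symm (right hab hca.symm hG))

theorem AlmostDecisive.inter [Fintype X] (hX : 3 ≤ Fintype.card X)
    (hF : IsSWF {P : Profile n X | IsProfile P} F)
    (hU : Unanimity {P : Profile n X | IsProfile P} F)
    (hIIA : IIA {P : Profile n X | IsProfile P} F)
    (hG : AlmostDecisive {P : Profile n X | IsProfile P} F G)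
    (hH : AlmostDecisive {P : Profile n X | IsProfile P} F H) :
    AlmostDecisive {P : Profile n X | IsProfile P} F (G ∩ H) := by
  obtain ⟨a, b, c, hab, hac, hbc⟩ := Fintype.two_lt_card_iff.1 hX
  exact ((hG a b hab).inter hF hIIA hab hbc hac (hH b c hbc)).almostDecisive hX hF hU hIIA hac

theorem almostDecisive_or_compl [Fintype X] (hX : 3 ≤ Fintype.card X)
    (hF : IsSWF {P : Profile n X | IsProfile P} F)
    (hU : Unanimity {P : Profile n X | IsProfile P} F)
    (hIIA : IIA {P : Profile n X | IsProfile P} F) (G : Set (Fin n)) :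
    AlmostDecisive {P : Profile n X | IsProfile P} F G ∨
      AlmostDecisive {P : Profile n X | IsProfile P} F Gᶜ := by
  obtain ⟨a, b, c, hab, hac, hbc⟩ := Fintype.two_lt_card_iff.1 hX
  obtain ⟨P, hP, hPi⟩ := exists_isProfile_inter hab hbc hac G univ
  refine ((hF P hP).2.2 a b hab).imp (fun h => ?_) fun h => ?_
  · refine AlmostDecisivePair.almostDecisive hX hF hU hIIA hab fun Q hQ hQi => ?_
    exact (hIIA P hP Q hQ a b fun i => (hPi i).1.trans (hQi i).symm).1 h
  · refine AlmostDecisivePair.almostDecisive hX hF hU hIIA hab.symm fun Q hQ hQi => ?_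
    refine (hIIA P hP Q hQ b a fun i => ?_).1 h
    rw [← (hP i).not_iff hab, (hPi i).1, hQi i, mem_compl_iff]

theorem not_almostDecisive_empty (hF : IsSWF {P : Profile n X | IsProfile P} F)
    (hU : Unanimity {P : Profile n X | IsProfile P} F) (hab : a ≠ b) :
    ¬ AlmostDecisive {P : Profile n X | IsProfile P} F ∅ := by
  intro h
  classical
  obtain ⟨P, hP, hPu⟩ := exists_isProfile_of_rank (n := n) (X := X) fun _ x =>
    if x = b then 0 else 1
  have hba (i : Fin n) : P i b a := by simp [hPu i b a, hab]
  exact (hF P hP).asymm (hU P hP b a hba)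
    (h a b hab P hP fun i => iff_of_false ((hP i).asymm (hba i)) (notMem_empty i))

end

/-- Arrow's impossibility theorem on the unrestricted domain `W(X)^n`. -/
theorem arrow_unrestricted {X : Type*} [Fintype X] {n : ℕ}
    (hX : 3 ≤ Fintype.card X) (hn : 2 ≤ n)
    (F : Profile n X → X → X → Prop)
    (hF : IsSWF {P : Profile n X | IsProfile P} F)
    (hU : Unanimity {P : Profile n X | IsProfile P} F)
    (hIIA : IIA {P : Profile n X | IsProfile P} F) :
    Dictatorial {P : Profile n X | IsProfile P} F := by
  obtain ⟨x, y, -, hxy, -⟩ := Fintype.two_lt_card_iff.1 hX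
  have h_empty := not_almostDecisive_empty hF hU hxy
  obtain ⟨d, hd⟩ : ∃ d, AlmostDecisive {P : Profile n X | IsProfile P} F {d} := by
    by_contra! h
    have h_compl (s : Finset (Fin n)) :
        AlmostDecisive {P : Profile n X | IsProfile P} F (s : Set (Fin n))ᶜ := by
      induction s using Finset.induction_on with
      | empty => simpa using almostDecisive_univ hU
      | insert d s _ ih =>
        rw [Finset.coe_insert, insert_eq, compl_union]
        exact ((almostDecisive_or_compl hX hF hU hIIA {d}).resolve_left (h d)).inter
          hX hF hU hIIA ih
    exact h_empty (by simpa using h_compl Finset.univ)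
  refine ⟨d, fun P hP a b hPd => ?_⟩
  have hab : a ≠ b := by
    rintro rfl
    exact (hP d).1 a hPd
  obtain h | h := almostDecisive_or_compl hX hF hU hIIA {i | P i a b}
  · exact h a b hab P hP fun _ => Iff.rfl
  · refine absurd (hd.inter hX hF hU hIIA h) ?_
    rwa [singleton_inter_eq_empty.2 (not_not_intro hPd)]

end ArrowSC
end

section
/- Let F be an SWF on a domain D satisfying IIA, and let 𝒢 be the set of all coalitions that are almost-decisive w.r.t. F. If 𝒢 satisfies: (1) ∅ ∉ 𝒢; (2) for every coalition G ⊆ N, G ∈ 𝒢 or N \ G ∈ 𝒢; and (3) if G, G' ∈ 𝒢 then G ∩ G' ∈ 𝒢; then F is dictatorial. -/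
open Set
namespace ArrowSC

/-- A nonempty family of subsets of a finite type that is closed under binary intersections and
does not contain the empty set has a common point. -/
theorem exists_forall_mem_of_inter_mem {α : Type*} [Finite α] {𝒢 : Set (Set α)}
    (hne : 𝒢.Nonempty) (hempty : ∅ ∉ 𝒢) (hinter : ∀ G ∈ 𝒢, ∀ G' ∈ 𝒢, G ∩ G' ∈ 𝒢) :
    ∃ d, ∀ G ∈ 𝒢, d ∈ G := by
  obtain ⟨M, hM⟩ := 𝒢.toFinite.exists_minimal hne
  obtain ⟨d, hd⟩ : M.Nonempty := by
    rw [nonempty_iff_ne_empty]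
    rintro rfl
    exact hempty hM.prop
  exact ⟨d, fun G hG => (hM.le_of_le (hinter M hM.prop G hG) inter_subset_left hd).2⟩

/-- if the almost-decisive coalitions form an ultrafilter on `N`,
then `F` is dictatorial. -/
theorem ultrafilter_of_almost_decisive_dictator {X : Type*} [Fintype X] {n : ℕ}
    (hX : 3 ≤ Fintype.card X) (hn : 2 ≤ n)
    (D : Set (Profile n X)) (hD : IsDomain D)
    (F : Profile n X → X → X → Prop) (hF : IsSWF D F) (hIIA : IIA D F)
    (h1 : (∅ : Set (Fin n)) ∉ {G : Set (Fin n) | AlmostDecisive D F G})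
    (h2 : ∀ G : Set (Fin n),
      G ∈ {G : Set (Fin n) | AlmostDecisive D F G} ∨
      Gᶜ ∈ {G : Set (Fin n) | AlmostDecisive D F G})
    (h3 : ∀ G ∈ {G : Set (Fin n) | AlmostDecisive D F G},
      ∀ G' ∈ {G : Set (Fin n) | AlmostDecisive D F G},
        G ∩ G' ∈ {G : Set (Fin n) | AlmostDecisive D F G}) :
    Dictatorial D F := by
  obtain ⟨d, hd⟩ := exists_forall_mem_of_inter_mem
    ((h2 univ).elim (fun h => ⟨_, h⟩) (fun h => ⟨_, h⟩)) h1 h3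
  refine ⟨d, fun P hP a b hab => ?_⟩
  have hne : a ≠ b := by
    rintro rfl
    exact (hD.2 P hP d).1 a hab
  have hG : AlmostDecisive D F {i | P i a b} :=
    (h2 {i | P i a b}).resolve_right fun h => hd _ h hab
  exact hG a b hne P hP fun _ => Iff.rfl

end ArrowSC
end

section
/- Let G be a coalition with ∅ ≠ G ≠ N, let Y = {α,β,γ} ⊆ X be a set of three distinct alternatives, and let F be an SWF on a domain D satisfying unanimity and IIA. Assume D_2(G,Y) ⊆ D|_Y. Then for all distinct a,b,c ∈ Y: (1) for every profile P ∈ D such that for all i, (a P_i c iff i ∈ G) and (b P_i a iff i ∉ G), it is not the case that F(P) ranks both a above c and b above a; (2) for every profile P ∈ D such that for all i, (a P_i c iff i ∉ G) and (b P_i a iff i ∈ G), it is not the case that F(P) ranks both c above a and a above b. -/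
open Set
namespace ArrowSC

theorem IsSTO.asymm_s8 {X : Type*} {r : X → X → Prop} (h : IsSTO r) {p q : X} (hpq : r p q) :
    ¬ r q p :=
  fun hqp => h.1 p (h.2.1 p q p hpq hqp)

theorem IsSTO.not_iff_s8 {X : Type*} {r : X → X → Prop} (h : IsSTO r) {p q : X} (hpq : p ≠ q) :
    ¬ r p q ↔ r q p :=
  ⟨(h.2.2 p q hpq).resolve_left, fun hqp => h.asymm_s8 hqp⟩

/-- Under IIA, one profile in which exactly `G` supports `p` over `q` and society follows `G`
makes `G` almost-decisive over `(p, q)`. -/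
theorem IIA.almostDecisivePair {n : ℕ} {X : Type*} {D : Set (Profile n X)}
    {F : Profile n X → X → X → Prop} (hIIA : IIA D F) {G : Set (Fin n)} {p q : X}
    {P : Profile n X} (hP : P ∈ D) (hG : ∀ i, P i p q ↔ i ∈ G) (hF : F P p q) :
    AlmostDecisivePair D F G p q :=
  fun P' hP' hG' => (hIIA P hP P' hP' p q fun i => (hG i).trans (hG' i).symm).1 hF

/-- The subprofile `(G : pqr, Gᶜ : qrp)` transfers almost-decisiveness from `(p, q)` to
`(p, r)`. -/
theorem HasPolarizedSubprofile.almostDecisivePair_right {n : ℕ} {X : Type*}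
    {D : Set (Profile n X)} (hD : IsDomain D) {F : Profile n X → X → X → Prop} (hF : IsSWF D F)
    (hU : Unanimity D F) (hIIA : IIA D F) {G : Set (Fin n)} {p q r : X}
    (h : HasPolarizedSubprofile D G p q r q r p) (hpq : AlmostDecisivePair D F G p q) :
    AlmostDecisivePair D F G p r := by
  obtain ⟨P, hP, hQ⟩ := h
  refine hIIA.almostDecisivePair hP (fun i => ?_)
    ((hF P hP).2.1 p q r (hpq P hP fun i => ?_) (hU P hP q r fun i => ?_))
  · exact ⟨fun hi => by_contra fun hG => (hD.2 P hP i).asymm_s8 hi ((hQ i).2 hG).2.1,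
      fun hG => ((hQ i).1 hG).2.2⟩
  · exact ⟨fun hi => by_contra fun hG => (hD.2 P hP i).asymm_s8 hi ((hQ i).2 hG).2.2,
      fun hG => ((hQ i).1 hG).1⟩
  · by_cases hG : i ∈ G
    · exact ((hQ i).1 hG).2.1
    · exact ((hQ i).2 hG).1

/-- The subprofile `(G : pqr, Gᶜ : rpq)` transfers almost-decisiveness from `(q, r)` to
`(p, r)`. -/
theorem HasPolarizedSubprofile.almostDecisivePair_left {n : ℕ} {X : Type*}
    {D : Set (Profile n X)} (hD : IsDomain D) {F : Profile n X → X → X → Prop} (hF : IsSWF D F)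
    (hU : Unanimity D F) (hIIA : IIA D F) {G : Set (Fin n)} {p q r : X}
    (h : HasPolarizedSubprofile D G p q r r p q) (hqr : AlmostDecisivePair D F G q r) :
    AlmostDecisivePair D F G p r := by
  obtain ⟨P, hP, hQ⟩ := h
  refine hIIA.almostDecisivePair hP (fun i => ?_)
    ((hF P hP).2.1 p q r (hU P hP p q fun i => ?_) (hqr P hP fun i => ?_))
  · exact ⟨fun hi => by_contra fun hG => (hD.2 P hP i).asymm_s8 hi ((hQ i).2 hG).1,
      fun hG => ((hQ i).1 hG).2.2⟩
  · by_cases hG : i ∈ G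
    · exact ((hQ i).1 hG).1
    · exact ((hQ i).2 hG).2.1
  · exact ⟨fun hi => by_contra fun hG => (hD.2 P hP i).asymm_s8 hi ((hQ i).2 hG).2.2,
      fun hG => ((hQ i).1 hG).2.1⟩

/-- If `D_2(G, Y) ⊆ D|_Y`, then a coalition `G` that is almost-decisive over one pair of `Y` is
almost-decisive over `Y`. -/
theorem D2sub.almostDecisiveOn {n : ℕ} {X : Type*}
    {D : Set (Profile n X)} (hD : IsDomain D) {F : Profile n X → X → X → Prop} (hF : IsSWF D F)
    (hU : Unanimity D F) (hIIA : IIA D F) {G : Set (Fin n)} {x y z : X}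
    (h : D2sub D G x y z) {p q : X} (hp : p ∈ ({x, y, z} : Set X))
    (hq : q ∈ ({x, y, z} : Set X)) (hpq : p ≠ q) (hG : AlmostDecisivePair D F G p q) :
    AlmostDecisiveOn D F G {x, y, z} := by
  obtain ⟨h₁, h₂, h₃, h₄, h₅, h₆⟩ := h
  have xy_xz := h₁.almostDecisivePair_right hD hF hU hIIA
  have zy_xy := h₂.almostDecisivePair_left hD hF hU hIIA
  have zx_zy := h₃.almostDecisivePair_right hD hF hU hIIA
  have yx_zx := h₄.almostDecisivePair_left hD hF hU hIIA
  have yz_yx := h₅.almostDecisivePair_right hD hF hU hIIA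
  have xz_yz := h₆.almostDecisivePair_left hD hF hU hIIA
  intro r hr s hs hrs
  simp only [mem_insert_iff, mem_singleton_iff] at hp hq hr hs
  rcases hp with rfl | rfl | rfl <;> rcases hq with rfl | rfl | rfl <;>
    rcases hr with rfl | rfl | rfl <;> rcases hs with rfl | rfl | rfl <;>
    first | contradiction | solve_by_elim (maxDepth := 8)

/-- Lemma "not-boundary-1" for `D_2(G, Y)`. -/
theorem not_boundary_one' {X : Type*} [Fintype X] {n : ℕ}
    (hX : 3 ≤ Fintype.card X) (hn : 2 ≤ n)
    (D : Set (Profile n X)) (hD : IsDomain D)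
    (F : Profile n X → X → X → Prop) (hF : IsSWF D F)
    (hU : Unanimity D F) (hIIA : IIA D F)
    (G : Set (Fin n)) (hGne : G ≠ ∅) (hGuniv : G ≠ univ)
    (x y z : X) (hxy : x ≠ y) (hyz : y ≠ z) (hxz : x ≠ z)
    (h2 : D2sub D G x y z) :
    ∀ a ∈ ({x, y, z} : Set X), ∀ b ∈ ({x, y, z} : Set X), ∀ c ∈ ({x, y, z} : Set X),
      a ≠ b → b ≠ c → a ≠ c →
      (∀ P ∈ D, (∀ i, (P i a c ↔ i ∈ G) ∧ (P i b a ↔ i ∉ G)) →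
        ¬ (F P a c ∧ F P b a)) ∧
      (∀ P ∈ D, (∀ i, (P i a c ↔ i ∉ G) ∧ (P i b a ↔ i ∈ G)) →
        ¬ (F P c a ∧ F P a b)) := by
  intro a ha b hb c hc hab hbc hac
  refine ⟨fun P hP hPG hFP => ?_, fun P hP hPG hFP => ?_⟩
  · have hG := hIIA.almostDecisivePair hP (fun i => (hPG i).1) hFP.1
    refine (hF P hP).asymm_s8 hFP.2
      (h2.almostDecisiveOn hD hF hU hIIA ha hc hac hG a ha b hb hab P hP fun i => ?_)
    rw [← (hD.2 P hP i).not_iff_s8 hab.symm, (hPG i).2, not_not]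
  · have hG := hIIA.almostDecisivePair hP
      (fun i => by rw [← (hD.2 P hP i).not_iff_s8 hac, (hPG i).1, not_not]) hFP.1
    exact (hF P hP).asymm_s8 hFP.2
      (h2.almostDecisiveOn hD hF hU hIIA hc ha hac.symm hG b hb a ha hab.symm P hP
        fun i => (hPG i).2)

end ArrowSC
end
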